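/- Let f₁, …, fₙ : X → ℝ^d be feature maps with E[fᵢ] = 0 for every i, let α ∈ ℝⁿ satisfy Σᵢ αᵢ = 1, set f = Σᵢ αᵢ fᵢ, and assume Cov(f) = I_d. Then the maximum of the H-score over all classifiers g : Y → ℝ^d equals half the quadratic form in α: sup over g of H(f, g) = (1/2) Σ_{i=1}^{n} Σ_{j=1}^{n} αᵢ αⱼ · tr( Σ_y P_Y(y) μ_{fᵢ}(y) μ_{fⱼ}(y)ᵀ ), and this supremum is attained at g*(y) = Σᵢ αᵢ μ_{fᵢ}(y). -/

import Mathlib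

noncomputable section

open Matrix BigOperators

variable {X Y : Type*} [Fintype X] [Fintype Y]

/-- Marginal distribution of `X` under the joint pmf `p`. -/
def PX (p : X × Y → ℝ) (x : X) : ℝ := ∑ y, p (x, y)

/-- Marginal distribution of `Y` under the joint pmf `p`. -/
def PY (p : X × Y → ℝ) (y : Y) : ℝ := ∑ x, p (x, y)

/-- Mean `E[f] = Σ_x P_X(x) f(x)` of a feature map. -/
def fmean {d : ℕ} (p : X × Y → ℝ) (f : X → Fin d → ℝ) : Fin d → ℝ :=
  ∑ x, PX p x • f x

/-- Covariance matrix `Cov(f) = Σ_x P_X(x) (f(x) − E[f])(f(x) − E[f])ᵀ`. -/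
def fcov {d : ℕ} (p : X × Y → ℝ) (f : X → Fin d → ℝ) : Matrix (Fin d) (Fin d) ℝ :=
  ∑ x, PX p x • vecMulVec (f x - fmean p f) (f x - fmean p f)

/-- Conditional mean `μ_f(y) = (1/P_Y(y)) Σ_x p(x,y) f(x)`. -/
def condMean {d : ℕ} (p : X × Y → ℝ) (f : X → Fin d → ℝ) (y : Y) : Fin d → ℝ :=
  (PY p y)⁻¹ • ∑ x, p (x, y) • f x

/-- Mean `E[g] = Σ_y P_Y(y) g(y)` of a classifier map. -/
def gmean {d : ℕ} (p : X × Y → ℝ) (g : Y → Fin d → ℝ) : Fin d → ℝ :=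
  ∑ y, PY p y • g y

/-- Covariance matrix `Cov(g) = Σ_y P_Y(y) (g(y) − E[g])(g(y) − E[g])ᵀ`. -/
def gcov {d : ℕ} (p : X × Y → ℝ) (g : Y → Fin d → ℝ) : Matrix (Fin d) (Fin d) ℝ :=
  ∑ y, PY p y • vecMulVec (g y - gmean p g) (g y - gmean p g)

/-- H-score `H(f,g) = Σ_{x,y} p(x,y) f(x)ᵀ g(y) − (1/2) tr(Cov(f)·Cov(g))`. -/
def Hscore {d : ℕ} (p : X × Y → ℝ) (f : X → Fin d → ℝ) (g : Y → Fin d → ℝ) : ℝ :=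
  (∑ x, ∑ y, p (x, y) * (f x ⬝ᵥ g y)) - (1 / 2) * (fcov p f * gcov p g).trace

/-- MCR loss `L(f,g) = Σ_x P_X(x) Σ_y [P_Y(y)(1 + f(x)ᵀ g(y)) − p(x,y)/P_X(x)]² / P_Y(y)`. -/
def Lloss {d : ℕ} (p : X × Y → ℝ) (f : X → Fin d → ℝ) (g : Y → Fin d → ℝ) : ℝ :=
  ∑ x, PX p x * ∑ y, (PY p y * (1 + f x ⬝ᵥ g y) - p (x, y) / PX p x) ^ 2 / PY p y

theorem PY_smul_condMean {X Y : Type*} [Fintype X] {d : ℕ} (p : X × Y → ℝ) (f : X → Fin d → ℝ) {y : Y}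
    (hy : PY p y ≠ 0) : PY p y • condMean p f y = ∑ x, p (x, y) • f x := by
  rw [condMean, smul_inv_smul₀ hy]

theorem gmean_condMean {d : ℕ} (p : X × Y → ℝ) (f : X → Fin d → ℝ)
    (hPY : ∀ y, PY p y ≠ 0) : gmean p (condMean p f) = fmean p f := by
  simp only [gmean, fmean, PY_smul_condMean p f (hPY _), PX, Finset.sum_smul]
  exact Finset.sum_comm

theorem sum_mul_dotProduct_eq {d : ℕ} (p : X × Y → ℝ) (f : X → Fin d → ℝ)
    (g : Y → Fin d → ℝ) (hPY : ∀ y, PY p y ≠ 0) :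
    ∑ x, ∑ y, p (x, y) * (f x ⬝ᵥ g y) = ∑ y, PY p y * (condMean p f y ⬝ᵥ g y) := by
  rw [Finset.sum_comm]
  refine Finset.sum_congr rfl fun y _ => ?_
  rw [← smul_eq_mul (PY p y), ← smul_dotProduct, PY_smul_condMean p f (hPY y), sum_dotProduct]
  simp only [smul_dotProduct, smul_eq_mul]

theorem trace_gcov {d : ℕ} (p : X × Y → ℝ) (g : Y → Fin d → ℝ) :
    (gcov p g).trace = ∑ y, PY p y * ((g y - gmean p g) ⬝ᵥ (g y - gmean p g)) := by
  simp only [gcov, trace_sum, trace_smul, trace_vecMulVec, smul_eq_mul]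

theorem condMean_sum_smul {X Y : Type*} [Fintype X] {d n : ℕ} (p : X × Y → ℝ)
    (α : Fin n → ℝ) (F : Fin n → X → Fin d → ℝ) (y : Y) :
    condMean p (fun x => ∑ i, α i • F i x) y = ∑ i, α i • condMean p (F i) y := by
  simp only [condMean, Finset.smul_sum]
  rw [Finset.sum_comm]
  refine Finset.sum_congr rfl fun i _ => Finset.sum_congr rfl fun x _ => ?_
  simp only [smul_smul]
  ring_nf

theorem fmean_sum_smul {d n : ℕ} (p : X × Y → ℝ) (α : Fin n → ℝ)
    (F : Fin n → X → Fin d → ℝ) :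
    fmean p (fun x => ∑ i, α i • F i x) = ∑ i, α i • fmean p (F i) := by
  simp only [fmean, Finset.smul_sum]
  rw [Finset.sum_comm]
  refine Finset.sum_congr rfl fun i _ => Finset.sum_congr rfl fun x _ => ?_
  rw [smul_comm]

/-- For a centred, whitened feature map the H-score only sees the centred classifier. -/
theorem Hscore_eq_of_fcov_eq_one {d : ℕ} (p : X × Y → ℝ) (f : X → Fin d → ℝ)
    (g : Y → Fin d → ℝ) (hPY : ∀ y, PY p y ≠ 0) (hmean : fmean p f = 0)
    (hcov : fcov p f = 1) :
    Hscore p f g = ∑ y, PY p y * (condMean p f y ⬝ᵥ (g y - gmean p g) -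
      1 / 2 * ((g y - gmean p g) ⬝ᵥ (g y - gmean p g))) := by
  have hzero : ∑ y, PY p y * (condMean p f y ⬝ᵥ gmean p g) = 0 := by
    have h : gmean p (condMean p f) ⬝ᵥ gmean p g = 0 := by
      rw [gmean_condMean p f hPY, hmean, zero_dotProduct]
    rw [gmean, sum_dotProduct] at h
    simpa only [smul_dotProduct, smul_eq_mul] using h
  rw [Hscore, hcov, one_mul, trace_gcov, sum_mul_dotProduct_eq p f g hPY, Finset.mul_sum,
    ← sub_zero (∑ y, PY p y * (condMean p f y ⬝ᵥ g y)), ← hzero, ← Finset.sum_sub_distrib,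
    ← Finset.sum_sub_distrib]
  refine Finset.sum_congr rfl fun y _ => ?_
  rw [dotProduct_sub (condMean p f y)]
  ring

theorem Hscore_condMean {d : ℕ} (p : X × Y → ℝ) (f : X → Fin d → ℝ)
    (hPY : ∀ y, PY p y ≠ 0) (hmean : fmean p f = 0) (hcov : fcov p f = 1) :
    Hscore p f (condMean p f) =
      1 / 2 * ∑ y, PY p y * (condMean p f y ⬝ᵥ condMean p f y) := by
  rw [Hscore_eq_of_fcov_eq_one p f _ hPY hmean hcov, gmean_condMean p f hPY, hmean,
    Finset.mul_sum]
  refine Finset.sum_congr rfl fun y _ => ?_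
  rw [sub_zero]
  ring

theorem dotProduct_sub_half_le {d : ℕ} (u v : Fin d → ℝ) :
    u ⬝ᵥ v - 1 / 2 * (v ⬝ᵥ v) ≤ 1 / 2 * (u ⬝ᵥ u) := by
  have h : 0 ≤ (u - v) ⬝ᵥ (u - v) := Finset.sum_nonneg fun i _ => mul_self_nonneg _
  rw [sub_dotProduct, dotProduct_sub, dotProduct_sub, dotProduct_comm v u] at h
  linarith

theorem Hscore_le_Hscore_condMean {d : ℕ} (p : X × Y → ℝ) (f : X → Fin d → ℝ)
    (g : Y → Fin d → ℝ) (hPY : ∀ y, 0 < PY p y) (hmean : fmean p f = 0)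
    (hcov : fcov p f = 1) : Hscore p f g ≤ Hscore p f (condMean p f) := by
  have hPY' : ∀ y, PY p y ≠ 0 := fun y => (hPY y).ne'
  rw [Hscore_condMean p f hPY' hmean hcov, Hscore_eq_of_fcov_eq_one p f g hPY' hmean hcov,
    Finset.mul_sum]
  refine Finset.sum_le_sum fun y _ => ?_
  rw [mul_left_comm]
  exact mul_le_mul_of_nonneg_left (dotProduct_sub_half_le _ _) (hPY y).le

/-- for a normalized ensemble `f = Σᵢ αᵢ fᵢ` (zero-mean `fᵢ`,
`Σᵢ αᵢ = 1`, `Cov(f) = I`), the supremum of `H(f,·)` over all classifiers is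
attained at `g*(y) = Σᵢ αᵢ μ_{fᵢ}(y)` and equals half the quadratic form
`Σ_{i,j} αᵢ αⱼ tr(Σ_y P_Y(y) μ_{fᵢ}(y) μ_{fⱼ}(y)ᵀ)`. -/
theorem hscore_sup_equals_half_quadratic_form
    {X Y : Type*} [Fintype X] [Fintype Y] [Nonempty X] [Nonempty Y] {d : ℕ}
    (p : X × Y → ℝ)
    (hp_nonneg : ∀ x y, 0 ≤ p (x, y))
    (hp_sum : ∑ x, ∑ y, p (x, y) = 1)
    (hPX_pos : ∀ x, 0 < PX p x) (hPY_pos : ∀ y, 0 < PY p y)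
    (n : ℕ) (F : Fin n → X → Fin d → ℝ)
    (hF_mean : ∀ i, fmean p (F i) = 0)
    (α : Fin n → ℝ) (hα : ∑ i, α i = 1)
    (f : X → Fin d → ℝ) (hf : ∀ x, f x = ∑ i, α i • F i x)
    (hf_cov : fcov p f = (1 : Matrix (Fin d) (Fin d) ℝ))
    (gstar : Y → Fin d → ℝ)
    (hgstar : ∀ y, gstar y = ∑ i, α i • condMean p (F i) y) :
    (∀ g : Y → Fin d → ℝ, Hscore p f g ≤ Hscore p f gstar) ∧
      Hscore p f gstar =
        (1 / 2) * ∑ i, ∑ j, α i * α j *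
          (∑ y, PY p y • vecMulVec (condMean p (F i) y) (condMean p (F j) y)).trace := by
  obtain rfl : f = fun x => ∑ i, α i • F i x := funext hf
  obtain rfl : gstar = condMean p (fun x => ∑ i, α i • F i x) :=
    funext fun y => (hgstar y).trans (condMean_sum_smul p α F y).symm
  have hmean : fmean p (fun x => ∑ i, α i • F i x) = 0 := by
    simp only [fmean_sum_smul, hF_mean, smul_zero, Finset.sum_const_zero]
  refine ⟨fun g => Hscore_le_Hscore_condMean p _ g hPY_pos hmean hf_cov, ?_⟩
  rw [Hscore_condMean p _ (fun y => (hPY_pos y).ne') hmean hf_cov]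
  congr 1
  simp only [condMean_sum_smul, trace_sum, trace_smul, trace_vecMulVec, sum_dotProduct,
    dotProduct_sum, smul_dotProduct, dotProduct_smul, smul_eq_mul, Finset.mul_sum]
  rw [Finset.sum_comm]
  refine Finset.sum_congr rfl fun i _ => ?_
  rw [Finset.sum_comm]
  refine Finset.sum_congr rfl fun j _ => Finset.sum_congr rfl fun y _ => ?_
  rw [dotProduct_comm (condMean p (F j) y)]
  ring

end
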